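/- Let E be a real inner product space and let f : E → ℝ be a differentiable function that is nonnegative (f(x) ≥ 0 for all x) and whose gradient is L-Lipschitz for some L > 0. Fix a step size α with 0 < α ≤ 1/L, and define the gradient descent iterates x_{n+1} := x_n − α·∇f(x_n) from an arbitrary initial point x_0. Then the iterates converge to stationarity: ‖∇f(x_n)‖ → 0 as n → ∞. -/

import Mathlib

/-- The descent lemma: a function with `L`-Lipschitz gradient lies below its quadratic upper model. -/
theorem le_add_inner_add_of_lipschitz_gradient {E : Type*} [NormedAddCommGroup E]
    [InnerProductSpace ℝ E] {f : E → ℝ} {g : E → E}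
    (hg : ∀ x, HasFDerivAt f (innerSL ℝ (g x)) x) {L : ℝ}
    (hlip : ∀ x y, ‖g x - g y‖ ≤ L * ‖x - y‖) (x d : E) :
    f (x + d) ≤ f x + inner ℝ (g x) d + L / 2 * ‖d‖ ^ 2 := by
  let φ : ℝ → ℝ := fun t => f (x + t • d) - t * inner ℝ (g x) d - L / 2 * ‖d‖ ^ 2 * t ^ 2
  have hφ (t : ℝ) : HasDerivAt φ
      (inner ℝ (g (x + t • d)) d - inner ℝ (g x) d - L * ‖d‖ ^ 2 * t) t := by
    have hline : HasDerivAt (fun t : ℝ => x + t • d) d t := by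
      simpa using ((hasDerivAt_id t).smul_const d).const_add x
    have hf := (hg (x + t • d)).comp_hasDerivAt t hline
    have hlin := (hasDerivAt_id t).mul_const (inner ℝ (g x) d)
    have hquad := (hasDerivAt_pow 2 t).const_mul (L / 2 * ‖d‖ ^ 2)
    refine ((hf.sub hlin).sub hquad).congr_deriv ?_
    simp only [innerSL_apply_apply]
    push_cast
    ring
  have hanti : AntitoneOn φ (Set.Icc 0 1) := by
    refine antitoneOn_of_deriv_nonpos (convex_Icc 0 1)
      (fun t _ => (hφ t).continuousAt.continuousWithinAt)
      (fun t _ => (hφ t).differentiableAt.differentiableWithinAt) fun t ht => ?_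
    rw [interior_Icc] at ht
    rw [(hφ t).deriv, ← inner_sub_left]
    have hcs := real_inner_le_norm (g (x + t • d) - g x) d
    have hl := hlip (x + t • d) x
    rw [add_sub_cancel_left, norm_smul, Real.norm_of_nonneg ht.1.le] at hl
    have := mul_le_mul_of_nonneg_right hl (norm_nonneg d)
    linarith
  have h := hanti (Set.left_mem_Icc.2 zero_le_one) (Set.right_mem_Icc.2 zero_le_one) zero_le_one
  simp only [φ, one_smul, zero_smul, add_zero] at h
  linarith

/-- A gradient step of size `α ≤ 1 / L` decreases `f` by at least `α / 2 * ‖∇f‖ ^ 2`. -/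
theorem gradient_step_le {E : Type*} [NormedAddCommGroup E]
    [InnerProductSpace ℝ E] {f : E → ℝ} {g : E → E}
    (hg : ∀ x, HasFDerivAt f (innerSL ℝ (g x)) x) {L : ℝ} (hL : 0 < L)
    (hlip : ∀ x y, ‖g x - g y‖ ≤ L * ‖x - y‖) {α : ℝ} (hα : 0 < α) (hα' : α ≤ 1 / L) (x : E) :
    f (x - α • g x) ≤ f x - α / 2 * ‖g x‖ ^ 2 := by
  have h := le_add_inner_add_of_lipschitz_gradient hg hlip x (-(α • g x))
  rw [← sub_eq_add_neg, inner_neg_right, real_inner_smul_right, real_inner_self_eq_norm_sq,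
    norm_neg, norm_smul, Real.norm_of_nonneg hα.le] at h
  have hαL : α * L ≤ 1 := (le_div_iff₀ hL).1 hα'
  have := mul_le_mul_of_nonneg_right hαL (by positivity : 0 ≤ α / 2 * ‖g x‖ ^ 2)
  linarith


/-- Gradient descent on a nonnegative function with L-Lipschitz gradient g
(the Fréchet derivative of f at x being ⟪g x, ·⟫), with step size 0 < α ≤ 1/L,
converges to stationarity: ‖g(xₙ)‖ → 0. -/
theorem stmt18 {E : Type*} [NormedAddCommGroup E] [InnerProductSpace ℝ E]
    (f : E → ℝ) (g : E → E)
    (hg : ∀ x, HasFDerivAt f (innerSL ℝ (g x)) x)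
    (hf : ∀ x, 0 ≤ f x)
    (L : ℝ) (hL : 0 < L)
    (hlip : ∀ x y, ‖g x - g y‖ ≤ L * ‖x - y‖)
    (α : ℝ) (hα : 0 < α) (hα' : α ≤ 1 / L)
    (x : ℕ → E) (hx : ∀ n, x (n + 1) = x n - α • g (x n)) :
    Filter.Tendsto (fun n => ‖g (x n)‖) Filter.atTop (nhds 0) := by
  have hstep (n : ℕ) : f (x (n + 1)) ≤ f (x n) - α / 2 * ‖g (x n)‖ ^ 2 := by
    rw [hx n]
    exact gradient_step_le hg hL hlip hα hα' (x n)
  have hanti : Antitone fun n => f (x n) := antitone_nat_of_succ_le fun n =>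
    (hstep n).trans (sub_le_self _ (by positivity))
  have hlim := tendsto_atTop_ciInf hanti ⟨0, by rintro _ ⟨n, rfl⟩; exact hf (x n)⟩
  have hdiff := (hlim.sub (hlim.comp (Filter.tendsto_add_atTop_nat 1))).const_mul (2 / α)
  rw [sub_self, mul_zero] at hdiff
  have hsq : Filter.Tendsto (fun n => ‖g (x n)‖ ^ 2) Filter.atTop (nhds 0) := by
    refine squeeze_zero (fun n => sq_nonneg _) (fun n => ?_) hdiff
    have h := mul_le_mul_of_nonneg_left (hstep n) (by positivity : 0 ≤ 2 / α)
    have hcancel : 2 / α * (α / 2 * ‖g (x n)‖ ^ 2) = ‖g (x n)‖ ^ 2 := by field_simp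
    simp only [Function.comp_apply]
    linarith
  simpa using hsq.sqrt
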